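/- Assume additionally the coverage hypothesis: for every x ∈ V ∖ V_i there exists a ∈ W such that either (x ∈ T_a ∪ {a} and V_i ⊆ S_a) or (x ∈ S_a ∪ {a} and V_i ⊆ T_a). Then for every pair of vertices u, v ∈ V_i, d_{G_i}(u,v) ≤ d(u,v) and d(u,v) ≤ d_{G_i}(u,v) + 4D'. (Lemmas 4.4 and 4.5: the combined augmented graph G_i, containing both hub vertices h_S and h_T, never overestimates original distances and underestimates them by at most the additive term 4D'.) -/

import Mathlib

open scoped ENNReal Classical

noncomputable section

/-- Total weight of a walk, given as the list of its vertices; weight `⊤` encodes a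
missing edge. -/
def walkCost {α : Type*} (w : α → α → ℝ≥0∞) : List α → ℝ≥0∞
  | [] => 0
  | [_] => 0
  | a :: b :: rest => w a b + walkCost w (b :: rest)

/-- Shortest-path distance in the weighted directed graph with weight function `w`
(`w x y = ⊤` means there is no edge from `x` to `y`): the infimum over directed walks
from `u` to `v` of their total weight. -/
def spDist {α : Type*} (w : α → α → ℝ≥0∞) (u v : α) : ℝ≥0∞ :=
  ⨅ (l : List α) (_ : l.head? = some u ∧ l.getLast? = some v), walkCost w l

/-- The augmented graph `G_i^S` on vertex set `V_i ∪ {h_S}` (`none` is the extra hub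
vertex `h_S`): it keeps the edges of `G` inside `V_i`, has a weight-`0` edge from each
`u ∈ V_i` to `h_S`, and an edge from `h_S` to each `v ∈ V_i` of weight
`max 0 (min_{a ∈ W_i^S} d(a, v) − D')` whenever `W_i^S ≠ ∅` and that minimum is finite. -/
def augS {V : Type*} (wG : V → V → ℝ≥0∞) (Vi WiS : Set V) (D' : ℝ≥0∞) :
    Option V → Option V → ℝ≥0∞
  | some u, some v => if u ∈ Vi ∧ v ∈ Vi then wG u v else ⊤
  | some u, none => if u ∈ Vi then 0 else ⊤
  | none, some v =>
      if v ∈ Vi ∧ WiS.Nonempty ∧ (⨅ a ∈ WiS, spDist wG a v) ≠ ⊤ then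
        (⨅ a ∈ WiS, spDist wG a v) - D'
      else ⊤
  | none, none => ⊤

/-- The augmented graph `G_i^T` on vertex set `V_i ∪ {h_T}` (`none` is the extra hub
vertex `h_T`): it keeps the edges of `G` inside `V_i`, has a weight-`0` edge from `h_T`
to each `v ∈ V_i`, and an edge from each `u ∈ V_i` to `h_T` of weight
`max 0 (min_{a ∈ W_i^T} d(u, a) − D')` whenever `W_i^T ≠ ∅` and that minimum is finite. -/
def augT {V : Type*} (wG : V → V → ℝ≥0∞) (Vi WiT : Set V) (D' : ℝ≥0∞) :
    Option V → Option V → ℝ≥0∞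
  | some u, some v => if u ∈ Vi ∧ v ∈ Vi then wG u v else ⊤
  | none, some v => if v ∈ Vi then 0 else ⊤
  | some u, none =>
      if u ∈ Vi ∧ WiT.Nonempty ∧ (⨅ a ∈ WiT, spDist wG u a) ≠ ⊤ then
        (⨅ a ∈ WiT, spDist wG u a) - D'
      else ⊤
  | none, none => ⊤

/-- The combined augmented graph `G_i` on vertex set `V_i ∪ {h_S, h_T}`
(`Sum.inr false` is the hub `h_S`, `Sum.inr true` is the hub `h_T`); its edge set is the
union of the edge sets of `G_i^S` and `G_i^T`. -/
def augC {V : Type*} (wG : V → V → ℝ≥0∞) (Vi WiS WiT : Set V) (D' : ℝ≥0∞) :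
    V ⊕ Bool → V ⊕ Bool → ℝ≥0∞
  | Sum.inl u, Sum.inl v => if u ∈ Vi ∧ v ∈ Vi then wG u v else ⊤
  | Sum.inl u, Sum.inr false => if u ∈ Vi then 0 else ⊤
  | Sum.inr false, Sum.inl v =>
      if v ∈ Vi ∧ WiS.Nonempty ∧ (⨅ a ∈ WiS, spDist wG a v) ≠ ⊤ then
        (⨅ a ∈ WiS, spDist wG a v) - D'
      else ⊤
  | Sum.inr true, Sum.inl v => if v ∈ Vi then 0 else ⊤
  | Sum.inl u, Sum.inr true =>
      if u ∈ Vi ∧ WiT.Nonempty ∧ (⨅ a ∈ WiT, spDist wG u a) ≠ ⊤ then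
        (⨅ a ∈ WiT, spDist wG u a) - D'
      else ⊤
  | Sum.inr _, Sum.inr _ => ⊤

theorem spDist_le_walk {α : Type*} (w : α → α → ℝ≥0∞) {u v : α} (l : List α)
    (h1 : l.head? = some u) (h2 : l.getLast? = some v) : spDist w u v ≤ walkCost w l :=
  iInf₂_le l ⟨h1, h2⟩

theorem spDist_self_zero {α : Type*} (w : α → α → ℝ≥0∞) (u : α) : spDist w u u = 0 := by
  have := spDist_le_walk w (u := u) (v := u) [u] rfl rfl
  simpa [walkCost] using this

theorem spDist_step {α : Type*} (w : α → α → ℝ≥0∞) (x y z : α) :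
    spDist w x z ≤ w x y + spDist w y z := by
  rw [← tsub_le_iff_left]
  refine le_iInf₂ fun l hl => ?_
  rw [tsub_le_iff_left]
  match l, hl with
  | b :: r, ⟨h1, h2⟩ =>
    simp only [List.head?_cons, Option.some.injEq] at h1
    subst h1
    exact spDist_le_walk w (x :: b :: r) rfl (by simpa using h2)

theorem spDist_walk_tri {α : Type*} (w : α → α → ℝ≥0∞) (y z : α) (l : List α) :
    ∀ x, l.head? = some x → l.getLast? = some y →
      spDist w x z ≤ walkCost w l + spDist w y z := by
  induction l with
  | nil => intro x h; simp at h
  | cons a r ih =>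
    intro x h1 h2
    simp only [List.head?_cons, Option.some.injEq] at h1
    subst h1
    cases r with
    | nil =>
      simp at h2
      subst h2
      simp [walkCost]
    | cons b r =>
      have := ih b rfl (by simpa using h2)
      calc spDist w a z ≤ w a b + spDist w b z := spDist_step w a b z
        _ ≤ w a b + (walkCost w (b :: r) + spDist w y z) := by gcongr
        _ = _ := by simp [walkCost, add_assoc]

theorem spDist_tri {α : Type*} (w : α → α → ℝ≥0∞) (x y z : α) :
    spDist w x z ≤ spDist w x y + spDist w y z := by
  rw [← tsub_le_iff_right]
  refine le_iInf₂ fun l hl => ?_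
  rw [tsub_le_iff_right]
  exact spDist_walk_tri w y z l x hl.1 hl.2

theorem spDist_split {α : Type*} (w : α → α → ℝ≥0∞) (v x : α) (l : List α) :
    ∀ u, l.head? = some u → l.getLast? = some v → x ∈ l →
      spDist w u x + spDist w x v ≤ walkCost w l := by
  induction l with
  | nil => intro x h; simp at h
  | cons a r ih =>
    intro u h1 h2 hx
    by_cases hxa : x = a
    · simp only [List.head?_cons, Option.some.injEq] at h1
      subst h1 hxa
      rw [spDist_self_zero, zero_add]
      exact spDist_le_walk w _ rfl h2
    · simp only [List.head?_cons, Option.some.injEq] at h1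
      subst h1
      cases r with
      | nil => simp at hx; exact absurd hx hxa
      | cons b r =>
        have := ih b rfl (by simpa using h2) (by simpa [hxa] using hx)
        calc spDist w a x + spDist w x v
            ≤ w a b + spDist w b x + spDist w x v := by gcongr; exact spDist_step w a b x
          _ = w a b + (spDist w b x + spDist w x v) := add_assoc _ _ _
          _ ≤ w a b + walkCost w (b :: r) := by gcongr
          _ = _ := by simp [walkCost]

theorem walkCost_map_inl {V : Type*} (wG : V → V → ℝ≥0∞) (Vi A B : Set V) (D' : ℝ≥0∞)
    (l : List V) (h : ∀ x ∈ l, x ∈ Vi) :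
    walkCost (augC wG Vi A B D') (l.map Sum.inl) = walkCost wG l := by
  induction l with
  | nil => rfl
  | cons a r ih =>
    cases r with
    | nil => rfl
    | cons b r =>
      have := ih (fun x hx => h x (List.mem_cons_of_mem _ hx))
      simp only [List.map_cons] at this
      simp [walkCost, this, augC, h a, h b]

/-- Invariant of the suffix of a walk starting at the given vertex. -/
def sufInv {V : Type*} (wG : V → V → ℝ≥0∞) (Vi : Set V) (D' : ℝ≥0∞) (v : V) (C : ℝ≥0∞) :
    V ⊕ Bool → Prop
  | Sum.inl y => spDist wG y v ≤ C + 2 * D' ∨ ∀ u ∈ Vi, spDist wG u v ≤ C + 4 * D'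
  | Sum.inr false => ∀ u ∈ Vi, spDist wG u v ≤ C + 4 * D'
  | Sum.inr true => True

theorem sufInv_top {V : Type*} (wG : V → V → ℝ≥0∞) (Vi : Set V) (D' : ℝ≥0∞) (v : V)
    (x : V ⊕ Bool) : sufInv wG Vi D' v ⊤ x := by
  rcases x with y | (_ | _) <;> simp [sufInv]

theorem sufInv_step {V : Type*} (wG : V → V → ℝ≥0∞) (Vi A B : Set V) (D' : ℝ≥0∞) (v : V)
    (hv : v ∈ Vi)
    (hA : ∀ a ∈ A, ∀ u ∈ Vi, spDist wG u a ≤ D')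
    (hB : ∀ a ∈ B, ∀ u ∈ Vi, spDist wG a u ≤ D')
    (C : ℝ≥0∞) (x y : V ⊕ Bool) (h : sufInv wG Vi D' v C y) :
    sufInv wG Vi D' v (augC wG Vi A B D' x y + C) x := by
  rcases x with x | (_ | _)
  · rcases y with y | (_ | _)
    · simp only [augC]
      split_ifs with hxy
      · rcases h with h | h
        · left
          calc spDist wG x v ≤ wG x y + spDist wG y v := spDist_step _ _ _ _
            _ ≤ wG x y + (C + 2 * D') := by gcongr
            _ = _ := by ring
        · right
          intro u hu
          refine (h u hu).trans ?_
          gcongr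
          exact le_add_self
      · rw [top_add]; exact sufInv_top _ _ _ _ _
    · right
      intro u hu
      refine (h u hu).trans ?_
      gcongr
      exact le_add_self
    · simp only [augC]
      split_ifs with hx
      · left
        have h1 : spDist wG x v - D' ≤ ⨅ a ∈ B, spDist wG x a := by
          refine le_iInf₂ fun a ha => ?_
          rw [tsub_le_iff_right]
          refine (spDist_tri wG x a v).trans ?_
          gcongr
          exact hB a ha v hv
        have h2 : (⨅ a ∈ B, spDist wG x a) ≤ ((⨅ a ∈ B, spDist wG x a) - D') + D' :=
          le_tsub_add
        calc spDist wG x v ≤ (⨅ a ∈ B, spDist wG x a) + D' := tsub_le_iff_right.1 h1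
          _ ≤ ((⨅ a ∈ B, spDist wG x a) - D') + D' + D' := by gcongr
          _ = ((⨅ a ∈ B, spDist wG x a) - D') + 2 * D' := by ring
          _ ≤ _ := by gcongr; exact le_self_add
      · rw [top_add]; exact sufInv_top _ _ _ _ _
  · rcases y with y | y
    · simp only [augC]
      split_ifs with hy
      · intro u hu
        rcases h with h | h
        · have h1 : spDist wG u y - D' ≤ ⨅ a ∈ A, spDist wG a y := by
            refine le_iInf₂ fun a ha => ?_
            rw [tsub_le_iff_left]
            refine (spDist_tri wG u a y).trans ?_
            gcongr
            exact hA a ha u hu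
          have h2 : (⨅ a ∈ A, spDist wG a y) ≤ ((⨅ a ∈ A, spDist wG a y) - D') + D' :=
            le_tsub_add
          calc spDist wG u v ≤ spDist wG u y + spDist wG y v := spDist_tri _ _ _ _
            _ ≤ ((⨅ a ∈ A, spDist wG a y) + D') + (C + 2 * D') := by
                gcongr
                exact tsub_le_iff_right.1 h1
            _ ≤ (((⨅ a ∈ A, spDist wG a y) - D') + D' + D') + (C + 2 * D') := by gcongr
            _ = _ := by ring
        · refine (h u hu).trans ?_
          gcongr
          exact le_add_self
      · rw [top_add]; exact sufInv_top _ _ _ _ _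
    · simp only [augC]
      rw [top_add]; exact sufInv_top _ _ _ _ _
  · trivial

theorem sufInv_walk {V : Type*} (wG : V → V → ℝ≥0∞) (Vi A B : Set V) (D' : ℝ≥0∞) (v : V)
    (hv : v ∈ Vi)
    (hA : ∀ a ∈ A, ∀ u ∈ Vi, spDist wG u a ≤ D')
    (hB : ∀ a ∈ B, ∀ u ∈ Vi, spDist wG a u ≤ D') (l : List (V ⊕ Bool)) :
    ∀ x, l.head? = some x → l.getLast? = some (Sum.inl v) →
      sufInv wG Vi D' v (walkCost (augC wG Vi A B D') l) x := by
  induction l with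
  | nil => intro x h; simp at h
  | cons a r ih =>
    intro x h1 h2
    simp only [List.head?_cons, Option.some.injEq] at h1
    subst h1
    cases r with
    | nil =>
      simp at h2
      subst h2
      left
      simp [spDist_self_zero]
    | cons b r =>
      exact sufInv_step wG Vi A B D' v hv hA hB _ a b (ih b rfl (by simpa using h2))

/-- Lemmas 4.4 and 4.5: under the coverage hypothesis, for all `u, v ∈ V_i`,
`d_{G_i}(u,v) ≤ d(u,v)` and `d(u,v) ≤ d_{G_i}(u,v) + 4 D'`. -/
theorem stmt6 {V : Type*} [Fintype V]
    (wG : V → V → ℝ≥0∞)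
    (W : Set V) (D' : ℝ≥0∞) (hD'top : D' ≠ ⊤)
    (hW : ∀ a ∈ W, ∀ x : V, min (spDist wG a x) (spDist wG x a) ≤ D')
    (S T : V → Set V)
    (hSa : ∀ a ∈ W, a ∉ S a) (hTa : ∀ a ∈ W, a ∉ T a)
    (hpart : ∀ a ∈ W, ∀ u : V, u ≠ a → (u ∈ S a ∧ u ∉ T a) ∨ (u ∈ T a ∧ u ∉ S a))
    (hS : ∀ a ∈ W, ∀ u ∈ S a, spDist wG u a ≤ spDist wG a u)
    (hT : ∀ a ∈ W, ∀ u ∈ T a, spDist wG a u ≤ spDist wG u a)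
    (Vi : Set V) (hViW : Disjoint Vi W)
    (hcover : ∀ x : V, x ∉ Vi → ∃ a ∈ W,
        ((x ∈ T a ∨ x = a) ∧ Vi ⊆ S a) ∨ ((x ∈ S a ∨ x = a) ∧ Vi ⊆ T a))
    (u v : V) (hu : u ∈ Vi) (hv : v ∈ Vi) :
    spDist (augC wG Vi {a ∈ W | Vi ⊆ S a} {a ∈ W | Vi ⊆ T a} D')
        (Sum.inl u) (Sum.inl v) ≤ spDist wG u v ∧
    spDist wG u v ≤
      spDist (augC wG Vi {a ∈ W | Vi ⊆ S a} {a ∈ W | Vi ⊆ T a} D')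
        (Sum.inl u) (Sum.inl v) + 4 * D' := by
  have hWS : ∀ a ∈ W, ∀ x, x ∈ S a ∨ x = a → spDist wG x a ≤ D' := by
    rintro a ha x (hx | rfl)
    · have := hW a ha x
      rwa [min_eq_right (hS a ha x hx)] at this
    · simp [spDist_self_zero]
  have hWT : ∀ a ∈ W, ∀ x, x ∈ T a ∨ x = a → spDist wG a x ≤ D' := by
    rintro a ha x (hx | rfl)
    · have := hW a ha x
      rwa [min_eq_left (hT a ha x hx)] at this
    · simp [spDist_self_zero]
  constructor
  · refine le_iInf₂ fun l hl => ?_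
    by_cases hall : ∀ x ∈ l, x ∈ Vi
    · rw [← walkCost_map_inl wG Vi {a ∈ W | Vi ⊆ S a} {a ∈ W | Vi ⊆ T a} D' l hall]
      exact spDist_le_walk _ _ (by simp [hl.1]) (by simp [hl.2])
    · push Not at hall
      obtain ⟨x, hxl, hx⟩ := hall
      have hsp := spDist_split wG v x l u hl.1 hl.2 hxl
      by_cases htop : walkCost wG l = ⊤
      · rw [htop]; exact le_top
      have hux : spDist wG u x ≠ ⊤ := ne_top_of_le_ne_top htop (le_self_add.trans hsp)
      have hxv : spDist wG x v ≠ ⊤ := ne_top_of_le_ne_top htop (le_add_self.trans hsp)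
      obtain ⟨a, ha, ⟨hxa, hVi⟩ | ⟨hxa, hVi⟩⟩ := hcover x hx
      · have hm : (⨅ a ∈ {a ∈ W | Vi ⊆ S a}, spDist wG a v) ≤ D' + spDist wG x v := by
          refine (iInf₂_le a ⟨ha, hVi⟩).trans ((spDist_tri wG a x v).trans ?_)
          gcongr
          exact hWT a ha x hxa
        have hfin := ne_top_of_le_ne_top (ENNReal.add_ne_top.2 ⟨hD'top, hxv⟩) hm
        refine (spDist_le_walk _ [Sum.inl u, Sum.inr false, Sum.inl v] rfl rfl).trans ?_
        refine le_trans ?_ (le_add_self.trans hsp)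
        simp only [walkCost, augC]
        rw [if_pos hu, if_pos ⟨hv, ⟨a, ha, hVi⟩, hfin⟩, zero_add, add_zero]
        exact tsub_le_iff_left.2 hm
      · have hm : (⨅ a ∈ {a ∈ W | Vi ⊆ T a}, spDist wG u a) ≤ spDist wG u x + D' := by
          refine (iInf₂_le a ⟨ha, hVi⟩).trans ((spDist_tri wG u x a).trans ?_)
          gcongr
          exact hWS a ha x hxa
        have hfin := ne_top_of_le_ne_top (ENNReal.add_ne_top.2 ⟨hux, hD'top⟩) hm
        refine (spDist_le_walk _ [Sum.inl u, Sum.inr true, Sum.inl v] rfl rfl).trans ?_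
        refine le_trans ?_ (le_self_add.trans hsp)
        simp only [walkCost, augC]
        rw [if_pos hv, if_pos ⟨hu, ⟨a, ha, hVi⟩, hfin⟩, add_zero, add_zero]
        exact tsub_le_iff_right.2 hm
  · rw [← tsub_le_iff_right]
    refine le_iInf₂ fun l hl => ?_
    rw [tsub_le_iff_right]
    have := sufInv_walk wG Vi {a ∈ W | Vi ⊆ S a} {a ∈ W | Vi ⊆ T a} D' v hv
      (fun a ha u hu => hWS a ha.1 u (Or.inl (ha.2 hu)))
      (fun a ha u hu => hWT a ha.1 u (Or.inl (ha.2 hu))) l (Sum.inl u) hl.1 hl.2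
    rcases this with h | h
    · refine h.trans ?_
      gcongr
      norm_num
    · exact h u hu

end
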